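/- Let (R, 𝔪, k) → (S, 𝔫, k) be a flat local homomorphism of Cohen–Macaulay Noetherian local rings of prime characteristic p in which every parameter ideal (of R and of S respectively) is Frobenius closed. Assume the closed fiber S/𝔪S is a regular local ring, and assume R is F-stable, i.e., there exist a parameter ideal I of R and u ∈ R with I(u) = 𝔪. Then 𝔪S is a maximal element, under inclusion, of the set B(S) = {P ∈ Spec S : P = J(w) for some parameter ideal J of S and some w ∈ S}. -/

import Mathlib

/-- The `q`-th bracket power `I^{[q]}` of an ideal `I` in a ring of characteristic `p`
(for `q = p^e`): the ideal generated by the `q`-th powers of the elements of `I`. -/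
def bracketPow {R : Type*} [CommRing R] (I : Ideal R) (q : ℕ) : Ideal R :=
  Ideal.span ((fun a => a ^ q) '' (I : Set R))

/-- An ideal `I` of a ring of prime characteristic `p` is Frobenius closed if its Frobenius
closure `I^F = {x : x^q ∈ I^{[q]} for some q = p^e}` equals `I`, i.e. whenever
`x^{p^e} ∈ I^{[p^e]}` for some `e`, already `x ∈ I`. -/
def FrobeniusClosed {R : Type*} [CommRing R] (p : ℕ) (I : Ideal R) : Prop :=
  ∀ x : R, (∃ e : ℕ, x ^ p ^ e ∈ bracketPow I (p ^ e)) → x ∈ I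

/-- A parameter ideal of a `d`-dimensional Noetherian local ring: an ideal generated by a
system of parameters, i.e. by `d` elements generating an ideal primary to the maximal ideal
(equivalently, with radical equal to the maximal ideal). -/
def IsParameterIdeal {R : Type*} [CommRing R] [IsLocalRing R] (I : Ideal R) : Prop :=
  ∃ (n : ℕ) (x : Fin n → R), ringKrullDim R = n ∧ I = Ideal.span (Set.range x) ∧
    I.radical = IsLocalRing.maximalIdeal R

/-- A Noetherian local ring is Cohen–Macaulay if and only if some system of parameters is a
regular sequence; we take this characterization as the definition. -/
def IsCohenMacaulayLocal (R : Type*) [CommRing R] [IsLocalRing R] : Prop :=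
  ∃ (n : ℕ) (x : Fin n → R), ringKrullDim R = n ∧
    (Ideal.span (Set.range x)).radical = IsLocalRing.maximalIdeal R ∧
    RingTheory.Sequence.IsRegular R (List.ofFn x)

/-- `Ĩ(x)`: the ideal of all `c ∈ R` such that `c·x^q ∈ I^{[q]}` for every `q = p^e`. -/
def ITilde {R : Type*} [CommRing R] (p : ℕ) (I : Ideal R) (x : R) : Ideal R :=
  ⨅ e : ℕ, Submodule.colon (bracketPow I (p ^ e)) (Ideal.span {x ^ p ^ e})

/-- A regular local ring: a Noetherian local ring whose maximal ideal can be generated by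
`d = dim` elements. -/
def IsRegularLocal (A : Type*) [CommRing A] : Prop :=
  IsNoetherianRing A ∧ ∃ h : IsLocalRing A, ∃ (n : ℕ) (x : Fin n → A),
    ringKrullDim A = n ∧ @IsLocalRing.maximalIdeal A _ h = Ideal.span (Set.range x)

/-- `B(S)`: the set of primes of the form `J(w)` for a parameter ideal `J` and `w ∈ S`. -/
def bSet (p : ℕ) (S : Type*) [CommRing S] [IsLocalRing S] : Set (Ideal S) :=
  {P : Ideal S | P.IsPrime ∧
    ∃ (J : Ideal S) (w : S), IsParameterIdeal J ∧ P = ITilde p J w}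

namespace Ideal

variable {A : Type*} [CommRing A]

lemma mem_sup_span_singleton_iff {H : Ideal A} {x z : A} :
    x ∈ H ⊔ span {z} ↔ ∃ t, x - z * t ∈ H := by
  rw [sup_comm, mem_span_singleton_sup]
  constructor
  · rintro ⟨a, b, hb, rfl⟩
    exact ⟨a, by convert hb using 1; ring⟩
  · rintro ⟨t, ht⟩
    exact ⟨t, _, ht, by ring⟩

lemma span_singleton_le_of_mem {I : Ideal A} {x : A} (h : x ∈ I) : span {x} ≤ I :=
  (span_singleton_le_iff_mem I).2 h

/-- A list `z₁, …, zₙ` such that each `zᵢ` is a nonzerodivisor modulo `H + (z₁, …, zᵢ₋₁)`. -/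
def IsWeaklyRegularMod : Ideal A → List A → Prop
  | _, [] => True
  | H, z :: zs => (∀ t, z * t ∈ H → t ∈ H) ∧ IsWeaklyRegularMod (H ⊔ span {z}) zs

namespace IsWeaklyRegularMod

lemma top (zs : List A) : IsWeaklyRegularMod ⊤ zs := by
  induction zs with
  | nil => trivial
  | cons z zs ih => exact ⟨fun _ _ => trivial, by rwa [top_sup_eq]⟩

lemma append_iff {H : Ideal A} {l₁ l₂ : List A} :
    IsWeaklyRegularMod H (l₁ ++ l₂) ↔
      IsWeaklyRegularMod H l₁ ∧ IsWeaklyRegularMod (H ⊔ ofList l₁) l₂ := by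
  induction l₁ generalizing H with
  | nil => simp [IsWeaklyRegularMod]
  | cons z zs ih =>
    simp only [List.cons_append, IsWeaklyRegularMod, ih, ofList_cons, sup_assoc, and_assoc]

lemma of_sup_of_colon {H : Ideal A} {s : A} {zs : List A}
    (h₁ : IsWeaklyRegularMod (H ⊔ span {s}) zs)
    (h₂ : IsWeaklyRegularMod (Submodule.colon H {s}) zs) : IsWeaklyRegularMod H zs := by
  induction zs generalizing H with
  | nil => trivial
  | cons z zs ih =>
    have hz : ∀ t, z * t ∈ H → t ∈ H := by
      intro t ht
      obtain ⟨u, hu⟩ := mem_sup_span_singleton_iff.1 (h₁.1 t (le_sup_left (a := H) ht))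
      have h3 : z * u ∈ Submodule.colon H {s} := by
        rw [Submodule.mem_colon_singleton, smul_eq_mul]
        convert H.sub_mem ht (H.mul_mem_left z hu) using 1
        ring
      have h4 := h₂.1 u h3
      rw [Submodule.mem_colon_singleton, smul_eq_mul] at h4
      convert H.add_mem hu h4 using 1
      ring
    refine ⟨hz, ih ?_ ?_⟩
    · have := h₁.2
      rwa [sup_right_comm] at this
    · convert h₂.2 using 1
      ext c
      rw [Submodule.mem_colon_singleton, smul_eq_mul, mem_sup_span_singleton_iff,
        mem_sup_span_singleton_iff]
      constructor
      · rintro ⟨t, ht⟩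
        have h5 : z * t ∈ H ⊔ span {s} := mem_sup_span_singleton_iff.2 ⟨c, by
          convert H.neg_mem ht using 1; ring⟩
        obtain ⟨u, hu⟩ := mem_sup_span_singleton_iff.1 (h₁.1 t h5)
        refine ⟨u, ?_⟩
        rw [Submodule.mem_colon_singleton, smul_eq_mul]
        convert H.add_mem ht (H.mul_mem_left z hu) using 1
        ring
      · rintro ⟨t, ht⟩
        rw [Submodule.mem_colon_singleton, smul_eq_mul] at ht
        exact ⟨s * t, by convert ht using 1; ring⟩

lemma cons_pow {H : Ideal A} {z : A} {zs : List A} (h : IsWeaklyRegularMod H (z :: zs)) (k : ℕ) :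
    IsWeaklyRegularMod H (z ^ k :: zs) := by
  have hz : ∀ k t, z ^ k * t ∈ H → t ∈ H := by
    intro k
    induction k with
    | zero => intro t ht; simpa using ht
    | succ k ih => exact fun t ht => ih t (h.1 _ (by convert ht using 1; ring))
  refine ⟨hz k, ?_⟩
  induction k with
  | zero => simpa using top zs
  | succ k ih =>
    refine of_sup_of_colon (s := z ^ k) ?_ ?_
    · convert ih using 1
      rw [sup_assoc]
      congr 1
      exact sup_eq_right.2 (span_singleton_le_of_mem
        (mem_span_singleton.2 (pow_dvd_pow z k.le_succ)))
    · convert h.2 using 1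
      ext c
      rw [Submodule.mem_colon_singleton, smul_eq_mul, mem_sup_span_singleton_iff,
        mem_sup_span_singleton_iff]
      constructor
      · rintro ⟨t, ht⟩
        exact ⟨t, hz k _ (by convert ht using 1; ring)⟩
      · rintro ⟨t, ht⟩
        exact ⟨t, by convert H.mul_mem_left (z ^ k) ht using 1; ring⟩

lemma map_pow {H : Ideal A} {zs : List A} (h : IsWeaklyRegularMod H zs) (k : ℕ) :
    IsWeaklyRegularMod H (zs.map (· ^ k)) := by
  induction zs generalizing H with
  | nil => trivial
  | cons z zs ih => exact ⟨(h.cons_pow k).1, ih (h.cons_pow k).2⟩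

lemma inf_ofList_le {G : Ideal A} {zs : List A} (h : IsWeaklyRegularMod G zs) :
    G ⊓ ofList zs ≤ ofList zs * G := by
  induction zs generalizing G with
  | nil => simp
  | cons z zs ih =>
    rintro x ⟨hxG, hx⟩
    simp only [SetLike.mem_coe, ofList_cons] at hxG hx ⊢
    rw [sup_comm] at hx
    obtain ⟨s, hs⟩ := mem_sup_span_singleton_iff.1 hx
    have h1 : x - z * s ∈ G ⊔ span {z} :=
      mem_sup_span_singleton_iff.2 ⟨-s, by convert hxG using 1; ring⟩
    have h2 := ih h.2 ⟨h1, hs⟩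
    rw [mul_sup] at h2
    obtain ⟨y, hy, w, hw, hyw⟩ := Submodule.mem_sup.1 h2
    have hwz : w ∈ span {z} := (Ideal.mul_le_right : ofList zs * span {z} ≤ span {z}) hw
    obtain ⟨v, rfl⟩ := mem_span_singleton.1 hwz
    have hyG : y ∈ G := (Ideal.mul_le_right : ofList zs * G ≤ G) hy
    have hsv : z * (s + v) = x - y := by linear_combination hyw
    have h3 : s + v ∈ G := h.1 _ (hsv ▸ G.sub_mem hxG hyG)
    rw [sup_mul]
    have : x = z * (s + v) + y := by linear_combination -hyw
    rw [this]
    have hz : z * (s + v) ∈ span {z} * G := Ideal.mul_mem_mul (mem_span_singleton_self z) h3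
    exact Submodule.add_mem_sup hz hy

section Local

variable [IsLocalRing A] [IsNoetherianRing A]

lemma swap {H : Ideal A} {a b : A} {l : List A} (ha : a ∈ IsLocalRing.maximalIdeal A)
    (h : IsWeaklyRegularMod H (a :: b :: l)) : IsWeaklyRegularMod H (b :: a :: l) := by
  obtain ⟨h1, h2, h3⟩ := h
  have key : Submodule.colon H {b} ≤ H := by
    refine Submodule.le_of_le_smul_of_le_jacobson_bot (I := span {a})
      (IsNoetherian.noetherian _) ?_ ?_
    · rw [IsLocalRing.jacobson_eq_maximalIdeal ⊥ bot_ne_top]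
      exact span_singleton_le_of_mem ha
    · intro t ht
      rw [Submodule.mem_colon_singleton, smul_eq_mul, mul_comm] at ht
      obtain ⟨u, hu⟩ := mem_sup_span_singleton_iff.1 (h2 t (le_sup_left (a := H) ht))
      have h4 : b * u ∈ H := h1 _ (by
        convert H.sub_mem ht (H.mul_mem_left b hu) using 1; ring)
      have : t = (t - a * u) + a * u := by ring
      rw [this]
      refine Submodule.add_mem_sup hu (Ideal.mul_mem_mul (mem_span_singleton_self a) ?_)
      rwa [Submodule.mem_colon_singleton, smul_eq_mul, mul_comm]
  refine ⟨fun t ht => key ?_, fun s hs => ?_, by rwa [sup_right_comm]⟩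
  · rwa [Submodule.mem_colon_singleton, smul_eq_mul, mul_comm]
  · obtain ⟨t, ht⟩ := mem_sup_span_singleton_iff.1 hs
    have h4 : b * t ∈ H ⊔ span {a} := mem_sup_span_singleton_iff.2 ⟨s, by
      convert H.neg_mem ht using 1; ring⟩
    obtain ⟨r, hr⟩ := mem_sup_span_singleton_iff.1 (h2 t h4)
    refine mem_sup_span_singleton_iff.2 ⟨r, h1 _ ?_⟩
    convert H.add_mem ht (H.mul_mem_left b hr) using 1
    ring

lemma perm {H : Ideal A} {l₁ l₂ : List A} (h : l₁.Perm l₂)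
    (hm : ∀ x ∈ l₁, x ∈ IsLocalRing.maximalIdeal A) (hl : IsWeaklyRegularMod H l₁) :
    IsWeaklyRegularMod H l₂ := by
  induction h generalizing H with
  | nil => trivial
  | cons x _ ih => exact ⟨hl.1, ih (fun y hy => hm y (List.mem_cons_of_mem _ hy)) hl.2⟩
  | swap x y l => exact swap (hm y List.mem_cons_self) hl
  | trans h₁ _ ih₁ ih₂ => exact ih₂ (fun y hy => hm y (h₁.mem_iff.2 hy)) (ih₁ hm hl)

end Local

end IsWeaklyRegularMod

end Ideal

namespace Ideal

variable {A : Type*} [CommRing A]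

lemma exists_add_notMem_of_isAntichain (T : Finset (Ideal A)) (hT : ∀ P ∈ T, P.IsPrime)
    (hanti : IsAntichain (· ≤ ·) (T : Set (Ideal A))) (a : A) (I : Ideal A)
    (h : ∀ P ∈ T, a ∈ P → ¬ I ≤ P) : ∃ y ∈ I, ∀ P ∈ T, a + y ∉ P := by
  classical
  induction T using Finset.induction with
  | empty => exact ⟨0, I.zero_mem, by simp⟩
  | insert P T hPT ih =>
    obtain ⟨y, hy, hyT⟩ := ih (fun Q hQ => hT Q (Finset.mem_insert_of_mem hQ))
      (hanti.subset (by simp)) (fun Q hQ => h Q (Finset.mem_insert_of_mem hQ))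
    by_cases hP : a + y ∈ P
    · have hPprime := hT P (Finset.mem_insert_self P T)
      have hIP : ¬ I ≤ P := fun hI =>
        h P (Finset.mem_insert_self P T) ((P.add_mem_iff_left (hI hy)).1 hP) hI
      have hinf : ¬ T.inf id ≤ P := fun hle => by
        obtain ⟨Q, hQ, hQP⟩ := (hPprime.inf_le').1 hle
        exact hanti (Finset.mem_insert_of_mem hQ) (Finset.mem_insert_self P T)
          (fun e => hPT (e ▸ hQ)) hQP
      obtain ⟨u, huI, huP⟩ := Set.not_subset.1 hIP
      obtain ⟨v, hvT, hvP⟩ := Set.not_subset.1 hinf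
      refine ⟨y + u * v, I.add_mem hy (I.mul_mem_right v huI), fun Q hQ hmem => ?_⟩
      rw [← add_assoc] at hmem
      rcases Finset.mem_insert.1 hQ with rfl | hQT
      · exact (hPprime.mem_or_mem ((Q.add_mem_iff_right hP).1 hmem)).elim huP hvP
      · have hvQ : v ∈ Q := (Finset.inf_le hQT : T.inf id ≤ Q) hvT
        exact hyT Q hQT ((Q.add_mem_iff_left (Q.mul_mem_left u hvQ)).1 hmem)
    · refine ⟨y, hy, fun Q hQ => ?_⟩
      rcases Finset.mem_insert.1 hQ with rfl | hQT
      exacts [hP, hyT Q hQT]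

/-- Prime avoidance for cosets. -/
lemma exists_add_notMem_of_finite {T : Set (Ideal A)} (hfin : T.Finite)
    (hT : ∀ P ∈ T, P.IsPrime) (a : A) (I : Ideal A)
    (h : ∀ P ∈ T, a ∈ P → ¬ I ≤ P) : ∃ y ∈ I, ∀ P ∈ T, a + y ∉ P := by
  classical
  obtain ⟨y, hy, hyT⟩ := exists_add_notMem_of_isAntichain
    (hfin.toFinset.filter fun P => Maximal (· ∈ hfin.toFinset) P)
    (fun P hP => hT P (hfin.mem_toFinset.1 (Finset.mem_filter.1 hP).1))
    (fun P hP Q hQ hne hle => hne <| le_antisymm hle <|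
      (Finset.mem_filter.1 hP).2.2 (Finset.mem_filter.1 hQ).1 hle) a I
    (fun P hP => h P (hfin.mem_toFinset.1 (Finset.mem_filter.1 hP).1))
  refine ⟨y, hy, fun P hP hmem => ?_⟩
  obtain ⟨Q, hPQ, hQ⟩ := hfin.toFinset.exists_le_maximal (hfin.mem_toFinset.2 hP)
  exact hyT Q (Finset.mem_filter.2 ⟨hQ.1, hQ⟩) (hPQ hmem)

lemma exists_finite_primes_of_zeroDivisors [IsNoetherianRing A] (H : Ideal A) :
    ∃ T : Set (Ideal A), T.Finite ∧
      (∀ P ∈ T, P.IsPrime ∧ ∃ t ∉ H, ∀ x, x ∈ P ↔ x * t ∈ H) ∧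
      ∀ c, (∀ P ∈ T, c ∉ P) → ∀ t, c * t ∈ H → t ∈ H := by
  refine ⟨associatedPrimes A (A ⧸ H), associatedPrimes.finite A (A ⧸ H), fun P hP => ?_, ?_⟩
  · refine ⟨IsAssociatedPrime.isPrime hP, ?_⟩
    obtain ⟨hprime, x, hx⟩ := (isAssociatedPrime_iff.1 hP)
    obtain ⟨t, rfl⟩ := Ideal.Quotient.mk_surjective x
    have key : ∀ x, x ∈ P ↔ x * t ∈ H := fun x => by
      rw [hx, Submodule.mem_colon_singleton, Submodule.mem_bot, ← Ideal.Quotient.eq_zero_iff_mem]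
      rfl
    refine ⟨t, fun ht => hprime.ne_top ?_, key⟩
    rw [eq_top_iff_one, key, one_mul]
    exact ht
  · intro c hc t ht
    by_contra htH
    have : c ∈ ⋃ p ∈ associatedPrimes A (A ⧸ H), (p : Set A) := by
      rw [biUnion_associatedPrimes_eq_zero_divisors]
      exact ⟨Ideal.Quotient.mk H t, fun h => htH (Ideal.Quotient.eq_zero_iff_mem.1 h),
        Ideal.Quotient.eq_zero_iff_mem.2 ht⟩
    obtain ⟨P, hP, hcP⟩ := Set.mem_iUnion₂.1 this
    exact hc P hP hcP

lemma ringKrullDim_quotient_sup_span_singleton (H : Ideal A) (z : A) :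
    ringKrullDim (A ⧸ H ⊔ span {z}) = ringKrullDim ((A ⧸ H) ⧸ span {Quotient.mk H z}) := by
  rw [← ringKrullDim_eq_of_ringEquiv (DoubleQuot.quotQuotEquivQuotSup H (span {z})), map_span,
    Set.image_singleton]

lemma ringKrullDim_quotient_sup_span_singleton_add_one_le {H : Ideal A} {z : A}
    (hz : ∀ t, z * t ∈ H → t ∈ H) :
    ringKrullDim (A ⧸ H ⊔ span {z}) + 1 ≤ ringKrullDim (A ⧸ H) := by
  rw [ringKrullDim_quotient_sup_span_singleton]
  refine ringKrullDim_quotient_succ_le_of_nonZeroDivisor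
    (mem_nonZeroDivisors_iff_right.2 fun x hx => ?_)
  obtain ⟨t, rfl⟩ := Quotient.mk_surjective x
  rw [← map_mul, Quotient.eq_zero_iff_mem, mul_comm] at hx
  exact Quotient.eq_zero_iff_mem.2 (hz t hx)

lemma IsWeaklyRegularMod.ringKrullDim_add_length_le {H : Ideal A} {l : List A}
    (h : IsWeaklyRegularMod H l) :
    ringKrullDim (A ⧸ H ⊔ ofList l) + l.length ≤ ringKrullDim (A ⧸ H) := by
  induction l generalizing H with
  | nil =>
    have e : H ⊔ ofList [] = H := by simp
    simp [ringKrullDim_eq_of_ringEquiv (quotEquivOfEq e)]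
  | cons z zs ih =>
    rw [ofList_cons, ← sup_assoc, List.length_cons, Nat.cast_add, ← add_assoc]
    exact (add_le_add_left (ih h.2) 1).trans
      (ringKrullDim_quotient_sup_span_singleton_add_one_le h.1)

section Local

open IsLocalRing

variable [IsLocalRing A]

lemma radical_eq_maximalIdeal_iff_ringKrullDim {H : Ideal A} (hH : H ≠ ⊤) :
    H.radical = maximalIdeal A ↔ ringKrullDim (A ⧸ H) = 0 := by
  have := Quotient.nontrivial_iff.2 hH
  rw [← ringKrullDimZero_iff_ringKrullDim_eq_zero,
    Ideal.krullDimLE_zero_quotient_iff_forall_minimalPrimes_isMaximal]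
  constructor
  · intro h J hJ
    have hle : maximalIdeal A ≤ J := h ▸ (hJ.1.1.radical_le_iff.2 hJ.1.2)
    rw [le_antisymm (le_maximalIdeal hJ.1.1.ne_top) hle]
    infer_instance
  · intro h
    rw [← sInf_minimalPrimes]
    refine le_antisymm ?_ (le_sInf fun J hJ => (IsLocalRing.eq_maximalIdeal (h J hJ)).ge)
    obtain ⟨J, hJ⟩ := (Ideal.nonempty_minimalPrimes hH)
    exact (sInf_le hJ).trans (IsLocalRing.eq_maximalIdeal (h J hJ)).le

variable [IsNoetherianRing A]

lemma ringKrullDim_quotient_le_sup_span_singleton_add_one {H : Ideal A} (hH : H ≠ ⊤) {z : A}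
    (hz : z ∈ maximalIdeal A) :
    ringKrullDim (A ⧸ H) ≤ ringKrullDim (A ⧸ H ⊔ span {z}) + 1 := by
  have := Quotient.nontrivial_iff.2 hH
  have : IsLocalRing (A ⧸ H) := .of_surjective' (Quotient.mk H) Quotient.mk_surjective
  rw [ringKrullDim_quotient_sup_span_singleton]
  have h := ringKrullDim_le_ringKrullDim_quotient_add_encard {Quotient.mk H z} (by
    rw [Set.singleton_subset_iff, ringJacobson_eq_maximalIdeal]
    have := IsLocalHom.of_surjective (Quotient.mk H) Quotient.mk_surjective
    exact map_nonunit (Quotient.mk H) z hz)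
  simpa using h

lemma ringKrullDim_quotient_le_add_length {H : Ideal A} {l : List A} (hH : H ⊔ ofList l ≠ ⊤) :
    ringKrullDim (A ⧸ H) ≤ ringKrullDim (A ⧸ H ⊔ ofList l) + l.length := by
  induction l generalizing H with
  | nil =>
    have e : H ⊔ ofList [] = H := by simp
    simp [ringKrullDim_eq_of_ringEquiv (quotEquivOfEq e)]
  | cons z zs ih =>
    rw [ofList_cons, ← sup_assoc] at hH ⊢
    have hH' : H ⊔ span {z} ≠ ⊤ := ne_top_of_le_ne_top hH le_sup_left
    rw [List.length_cons, Nat.cast_add, ← add_assoc]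
    exact (ringKrullDim_quotient_le_sup_span_singleton_add_one
      (ne_top_of_le_ne_top hH' le_sup_left)
      (le_maximalIdeal hH' (mem_sup_right (mem_span_singleton_self z)))).trans
      (add_le_add_left (ih hH) 1)

end Local
end Ideal

namespace Ideal

open IsLocalRing

variable {A : Type*} [CommRing A] [IsLocalRing A] [IsNoetherianRing A]

/-- If the maximal ideal of `A ⧸ H` is generated by `dim (A ⧸ H)` elements, then `H` is prime
and these elements form a regular sequence modulo `H`. -/
theorem isPrime_and_isWeaklyRegularMod {H : Ideal A} {zs : List A}
    (hmax : H ⊔ ofList zs = maximalIdeal A)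
    (hdim : (zs.length : WithBot ℕ∞) ≤ ringKrullDim (A ⧸ H)) :
    H.IsPrime ∧ IsWeaklyRegularMod H zs := by
  obtain ⟨k, hk⟩ : ∃ k, zs.length = k := ⟨_, rfl⟩
  induction k generalizing H zs with
  | zero =>
    obtain rfl := List.length_eq_zero_iff.1 hk
    have : H = maximalIdeal A := by simpa using hmax
    exact ⟨this ▸ inferInstance, trivial⟩
  | succ k ih =>
    obtain ⟨z, rest, rfl⟩ := List.exists_cons_of_length_eq_add_one hk
    rw [List.length_cons, Nat.add_right_cancel_iff] at hk
    have hHle : H ≤ maximalIdeal A := hmax ▸ le_sup_left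
    have hH : H ≠ ⊤ := ne_top_of_le_ne_top (maximalIdeal.isMaximal A).ne_top hHle
    have hmem : ∀ x ∈ z :: rest, x ∈ maximalIdeal A := fun x hx =>
      hmax ▸ mem_sup_right (subset_span hx)
    have step : ∀ c ∈ maximalIdeal A, (k : WithBot ℕ∞) ≤ ringKrullDim (A ⧸ H ⊔ span {c}) := by
      intro c hc
      have h1 := hdim.trans (ringKrullDim_quotient_le_sup_span_singleton_add_one hH hc)
      rw [List.length_cons, hk, Nat.cast_add, Nat.cast_one] at h1
      by_contra! hlt
      exact absurd (Nat.cast_le.1 ((Nat.cast_succ k).trans_le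
        (h1.trans (ENat.WithBot.add_one_le_natCast_iff.2 hlt)))) (by simp)
    have havoid : ∃ y ∈ ofList rest, ∀ P ∈ H.minimalPrimes, z + y ∉ P := by
      refine exists_add_notMem_of_finite H.finite_minimalPrimes_of_isNoetherianRing
        (fun P hP => hP.1.1) z _ fun P hP hz hle => ?_
      have hPmax : P = maximalIdeal A := by
        refine le_antisymm (le_maximalIdeal hP.1.1.ne_top) ?_
        rw [← hmax, ofList_cons]
        exact sup_le hP.1.2 (sup_le (span_singleton_le_of_mem hz) hle)
      have hrad : H.radical = maximalIdeal A := by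
        refine le_antisymm (le_maximalIdeal (by rwa [Ne, radical_eq_top])) ?_
        rw [radical_eq_sInf]
        refine le_sInf fun J hJ => ?_
        have := hP.2 ⟨hJ.2, hJ.1⟩ (hPmax ▸ le_maximalIdeal hJ.2.ne_top)
        exact hPmax ▸ this
      rw [(radical_eq_maximalIdeal_iff_ringKrullDim hH).1 hrad, List.length_cons] at hdim
      exact absurd (Nat.cast_le.1 (hdim.trans_eq Nat.cast_zero.symm)) (by simp)
    obtain ⟨y, hy, hyP⟩ := havoid
    have hym : y ∈ maximalIdeal A := hmax ▸ mem_sup_right (by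
      rw [ofList_cons]; exact mem_sup_right hy)
    have hcm : z + y ∈ maximalIdeal A := add_mem (hmem z (by simp)) hym
    have hcsup : H ⊔ span {z + y} ⊔ ofList rest = maximalIdeal A := by
      refine le_antisymm (sup_le (sup_le hHle (span_singleton_le_of_mem hcm))
        (span_le.2 fun x hx => hmem x (List.mem_cons_of_mem _ hx))) ?_
      rw [← hmax, ofList_cons]
      refine sup_le (le_sup_left.trans le_sup_left) (sup_le (span_singleton_le_of_mem ?_)
        le_sup_right)
      have := sub_mem (mem_sup_left (mem_sup_right (mem_span_singleton_self (z + y)))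
        : z + y ∈ H ⊔ span {z + y} ⊔ ofList rest) (mem_sup_right hy)
      simpa using this
    have hcprime := (ih hcsup (hk ▸ step _ hcm) hk).1
    obtain ⟨P, hP, hPle⟩ := exists_minimalPrimes_le (le_sup_left : H ≤ H ⊔ span {z + y})
    have hPH : P ≤ H := by
      refine Submodule.le_of_le_smul_of_le_jacobson_bot (I := span {z + y})
        (IsNoetherian.noetherian _) ?_ ?_
      · rw [jacobson_eq_maximalIdeal ⊥ bot_ne_top]
        exact span_singleton_le_of_mem hcm
      · intro x hx
        obtain ⟨t, ht⟩ := mem_sup_span_singleton_iff.1 (hPle hx)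
        have htP : (z + y) * t ∈ P := (P.sub_mem_iff_right hx).1 (hP.1.2 ht)
        have htP := (hP.1.1.mem_or_mem htP).resolve_left (hyP P hP)
        have := Submodule.add_mem_sup ht
          (Submodule.smul_mem_smul (mem_span_singleton_self (z + y)) htP)
        simpa using this
    have hprime : H.IsPrime := le_antisymm hPH hP.1.2 ▸ hP.1.1
    refine ⟨hprime, fun t ht => (hprime.mem_or_mem ht).resolve_left fun hz => ?_,
      (ih (by rwa [sup_assoc, ← ofList_cons]) (hk ▸ step z (hmem z (by simp))) hk).2⟩
    have hmax' : H ⊔ ofList rest = maximalIdeal A := by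
      rw [← hmax, ofList_cons, ← sup_assoc, sup_eq_left.2 (span_singleton_le_of_mem hz)]
    have h2 := hdim.trans (ringKrullDim_quotient_le_add_length (H := H) (l := rest)
      (hmax' ▸ (maximalIdeal.isMaximal A).ne_top))
    rw [hmax', (radical_eq_maximalIdeal_iff_ringKrullDim
      (maximalIdeal.isMaximal A).ne_top).1 (IsPrime.radical inferInstance), zero_add] at h2
    exact absurd (Nat.cast_le.1 h2) (by simp)

lemma mem_of_forall_mem_sup_maximalIdeal_pow {H : Ideal A} (hH : H ≠ ⊤) {c : A}
    (hc : ∀ k, c ∈ H ⊔ maximalIdeal A ^ k) : c ∈ H := by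
  have := Quotient.nontrivial_iff.2 hH
  have : IsLocalRing (A ⧸ H) := .of_surjective' (Quotient.mk H) Quotient.mk_surjective
  have hm : (maximalIdeal A).map (Quotient.mk H) ≠ ⊤ := by
    have h := comap_map_of_surjective _ (Quotient.mk_surjective (I := H)) (maximalIdeal A)
    intro e
    rw [e, comap_top, ← RingHom.ker_eq_comap_bot, mk_ker, sup_eq_left.2 (le_maximalIdeal hH)] at h
    exact (maximalIdeal.isMaximal A).ne_top h.symm
  rw [← Quotient.eq_zero_iff_mem, ← mem_bot, ← iInf_pow_eq_bot_of_isLocalRing _ hm, mem_iInf]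
  intro k
  rw [← Ideal.map_pow]
  obtain ⟨a, ha, b, hb, rfl⟩ := Submodule.mem_sup.1 (hc k)
  rw [map_add, Quotient.eq_zero_iff_mem.2 ha, zero_add]
  exact mem_map_of_mem _ hb

end Ideal

namespace Ideal

open IsLocalRing

variable {R S : Type*} [CommRing R] [CommRing S] {f : R →+* S}

lemma exists_sum_of_mem_map {G : Ideal R} {x : S} (hx : x ∈ map f G) :
    ∃ (n : ℕ) (s : Fin n → S) (g : Fin n → R), (∀ i, g i ∈ G) ∧ ∑ i, s i * f (g i) = x := by
  obtain ⟨n, s, g, h⟩ := Submodule.mem_span_set'.1 hx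
  choose g' hg' hgf using fun i => (g i).2
  exact ⟨n, s, g', hg', by simpa [hgf] using h⟩

lemma mem_map_algebraMap_colon_of_mul_mem [Algebra R S] [Module.Flat R S] {G : Ideal R} {r : R}
    {c : S} (hc : c * algebraMap R S r ∈ map (algebraMap R S) G) :
    c ∈ map (algebraMap R S) (Submodule.colon G {r}) := by
  obtain ⟨n, s, g, hg, hsum⟩ := exists_sum_of_mem_map hc
  have hrel : ∑ i : Option (Fin n), (Option.elim i r fun i => -g i) • Option.elim i c s = 0 := by
    rw [Fintype.sum_option]
    simp only [Option.elim_none, Option.elim_some, Algebra.smul_def, map_neg, neg_mul,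
      Finset.sum_neg_distrib]
    rw [add_neg_eq_zero, mul_comm, ← hsum]
    exact Finset.sum_congr rfl fun i _ => mul_comm _ _
  obtain ⟨k, a, y, hy, ha⟩ := Module.Flat.isTrivialRelation_of_sum_smul_eq_zero (R := R) (M := S)
    (f := fun i : Option (Fin n) => Option.elim i r fun i => -g i)
    (x := fun i => Option.elim i c s) hrel
  have hmem : ∀ j, a none j ∈ Submodule.colon G {r} := fun j => by
    have hj := ha j
    rw [Fintype.sum_option] at hj
    simp only [Option.elim_none, Option.elim_some, neg_mul, Finset.sum_neg_distrib,
      add_neg_eq_zero] at hj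
    rw [Submodule.mem_colon_singleton, smul_eq_mul, mul_comm, hj]
    exact Ideal.sum_mem _ fun i _ => G.mul_mem_right _ (hg i)
  have hcy : c = ∑ j, a none j • y j := hy none
  rw [hcy]
  refine Ideal.sum_mem _ fun j _ => ?_
  rw [Algebra.smul_def]
  exact Ideal.mul_mem_right _ _ (mem_map_of_mem _ (hmem j))

lemma mem_map_colon_of_mul_mem (hf : f.Flat) {G : Ideal R} {r : R} {c : S}
    (hc : c * f r ∈ map f G) : c ∈ map f (Submodule.colon G {r}) :=
  @mem_map_algebraMap_colon_of_mul_mem R S _ _ f.toAlgebra hf G r c hc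

lemma colon_map_singleton (hf : f.Flat) (G : Ideal R) (r : R) :
    Submodule.colon (map f G) {f r} = map f (Submodule.colon G {r}) := by
  refine le_antisymm (fun c hc => mem_map_colon_of_mul_mem hf (Submodule.mem_colon_singleton.1 hc))
    (map_le_iff_le_comap.2 fun x hx => ?_)
  rw [mem_comap, Submodule.mem_colon_singleton, smul_eq_mul, ← map_mul]
  exact mem_map_of_mem f (Submodule.mem_colon_singleton.1 hx)

lemma IsWeaklyRegularMod.map (hf : f.Flat) {H : Ideal R} {xs : List R}
    (h : IsWeaklyRegularMod H xs) : IsWeaklyRegularMod (map f H) (xs.map f) := by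
  induction xs generalizing H with
  | nil => trivial
  | cons x xs ih =>
    refine ⟨fun t ht => ?_, ?_⟩
    · rw [mul_comm] at ht
      refine map_mono (fun y hy => h.1 y ?_) (mem_map_colon_of_mul_mem hf ht)
      rw [mul_comm]
      exact Submodule.mem_colon_singleton.1 hy
    · have := ih h.2
      rwa [map_sup, map_span, Set.image_singleton] at this

variable [IsLocalRing R]

/-- A sequence which is regular on the closed fiber of a flat map stays regular modulo the
extension of every ideal which is primary to the maximal ideal. -/
lemma IsWeaklyRegularMod.map_of_le_radical [IsNoetherianRing R] (hf : f.Flat) {zs : List S}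
    (h : IsWeaklyRegularMod (Ideal.map f (maximalIdeal R)) zs) (G : Ideal R)
    (hG : maximalIdeal R ≤ G.radical) : IsWeaklyRegularMod (Ideal.map f G) zs := by
  induction G using WellFoundedGT.induction with
  | ind G ih =>
    by_cases hle : maximalIdeal R ≤ G
    · rcases eq_or_ne G ⊤ with rfl | hne
      · rw [map_top]
        exact IsWeaklyRegularMod.top zs
      · rwa [le_antisymm (le_maximalIdeal hne) hle]
    · obtain ⟨r, hr, hrG⟩ := Set.not_subset.1 hle
      have hex : ∃ k, r ^ k ∈ G := hG hr
      classical
      obtain ⟨k, hk⟩ : ∃ k, Nat.find hex = k := ⟨_, rfl⟩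
      have hspec := Nat.find_spec hex
      rw [hk] at hspec
      cases k with
      | zero => exact absurd (G.mul_mem_left r hspec) (by simpa using hrG)
      | succ k =>
        have hkG : r ^ k ∉ G := Nat.find_min hex (by omega)
        have hle₁ : G ≤ G ⊔ span {r ^ k} := le_sup_left
        have hle₂ : G ≤ Submodule.colon G {r ^ k} := fun x hx =>
          Submodule.mem_colon_singleton.2 (G.mul_mem_right _ hx)
        refine of_sup_of_colon (s := f (r ^ k)) ?_ ?_
        · have := ih (G ⊔ span {r ^ k}) (lt_of_le_of_ne hle₁ fun e => hkG ?_)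
            (hG.trans (radical_mono hle₁))
          · rwa [map_sup, map_span, Set.image_singleton] at this
          · rw [e]
            exact mem_sup_right (mem_span_singleton_self _)
        · rw [colon_map_singleton hf]
          refine ih _ (lt_of_le_of_ne hle₂ fun e => hrG ?_) (hG.trans (radical_mono hle₂))
          rw [SetLike.mem_coe, e, Submodule.mem_colon_singleton, smul_eq_mul, ← pow_succ']
          exact hspec

lemma mem_map_maximalIdeal_sup_of_mul_mem [IsNoetherianRing R] (hf : f.Flat) {zs : List S}
    (h : IsWeaklyRegularMod (map f (maximalIdeal R)) zs) {G : Ideal R}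
    (hG : maximalIdeal R ≤ G.radical) {r : R} (hr : r ∉ G) {c : S}
    (hc : c * f r ∈ map f G ⊔ ofList zs) : c ∈ map f (maximalIdeal R) ⊔ ofList zs := by
  obtain ⟨g, hg, l, hl, hgl⟩ := Submodule.mem_sup.1 hc
  have hl' : l ∈ map f (G ⊔ span {r}) ⊓ ofList zs := by
    refine ⟨?_, hl⟩
    rw [eq_sub_of_add_eq' hgl, map_sup, map_span, Set.image_singleton]
    exact sub_mem (mem_sup_right (mul_mem_left _ _ (mem_span_singleton_self _)))
      (mem_sup_left hg)
  have hprod := (h.map_of_le_radical hf (G ⊔ span {r})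
    (hG.trans (radical_mono le_sup_left))).inf_ofList_le hl'
  rw [map_sup, map_span, Set.image_singleton, mul_sup] at hprod
  obtain ⟨g', hg', b, hb, hgb⟩ := Submodule.mem_sup.1 hprod
  obtain ⟨z, hz, rfl⟩ := mem_mul_span_singleton.1 hb
  have hcz : (c - z) * f r ∈ map f G := by
    have : (c - z) * f r = g + g' := by
      rw [sub_mul, ← hgl, ← hgb]; ring
    rw [this]
    exact Ideal.add_mem _ hg (mul_le_right hg')
  have hle : Submodule.colon G {r} ≤ maximalIdeal R := le_maximalIdeal fun e => hr <| by
    have h1 := Submodule.mem_colon_singleton.1 (e ▸ Submodule.mem_top : (1 : R) ∈ _)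
    simpa using h1
  have := Submodule.add_mem_sup (map_mono hle (mem_map_colon_of_mul_mem hf hcz)) hz
  simpa using this

lemma exists_sub_mem_map_maximalIdeal_pow_sup [IsLocalRing S] [IsLocalHom f]
    (hres : Function.Surjective (IsLocalRing.ResidueField.map f)) {zs : List S}
    (hmax : map f (maximalIdeal R) ⊔ ofList zs = maximalIdeal S) (k : ℕ) (v : S) :
    ∃ r, v - f r ∈ map f (maximalIdeal R ^ k) ⊔ ofList zs := by
  have key : ∀ s : S, ∃ r, s - f r ∈ maximalIdeal S := fun s => by
    obtain ⟨a, ha⟩ := hres (residue S s)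
    obtain ⟨r, rfl⟩ := residue_surjective a
    refine ⟨r, ?_⟩
    rw [← residue_eq_zero_iff, RingHom.map_sub, ← ha, ResidueField.map_residue, sub_self]
  induction k with
  | zero => exact ⟨0, by simp [map_top]⟩
  | succ k ih =>
    obtain ⟨r, hr⟩ := ih
    obtain ⟨a, ha, l, hl, hal⟩ := Submodule.mem_sup.1 hr
    obtain ⟨n, s, g, hg, hsum⟩ := exists_sum_of_mem_map ha
    choose t ht using fun i => key (s i)
    refine ⟨r + ∑ i, t i * g i, ?_⟩
    have : v - f (r + ∑ i, t i * g i) = ∑ i, (s i - f (t i)) * f (g i) + l := by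
      simp only [sub_mul, Finset.sum_sub_distrib, hsum, map_add, map_sum, map_mul]
      rw [← sub_sub, ← hal]
      ring
    rw [this]
    refine Ideal.add_mem _ (Ideal.sum_mem _ fun i _ => ?_) (mem_sup_right hl)
    have hi := ht i
    rw [← hmax] at hi
    obtain ⟨x, hx, y, hy, hxy⟩ := Submodule.mem_sup.1 hi
    rw [← hxy, add_mul, pow_succ', Ideal.map_mul]
    exact Submodule.add_mem_sup (mul_mem_mul hx (mem_map_of_mem f (hg i))) (mul_mem_right _ _ hy)

end Ideal

namespace Ideal

open IsLocalRing

section Dimension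

variable {A : Type*} [CommRing A] [IsLocalRing A] [IsNoetherianRing A] {l : List A}

omit [IsLocalRing A] [IsNoetherianRing A] in
lemma ofList_le_iff {l : List A} {I : Ideal A} : ofList l ≤ I ↔ ∀ x ∈ l, x ∈ I := span_le

omit [IsLocalRing A] [IsNoetherianRing A] in
lemma ringKrullDim_quotient_bot : ringKrullDim (A ⧸ (⊥ : Ideal A)) = ringKrullDim A :=
  ringKrullDim_eq_of_ringEquiv (RingEquiv.quotientBot A)

omit [IsLocalRing A] [IsNoetherianRing A] in
lemma ringKrullDim_quotient_bot_sup (I : Ideal A) :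
    ringKrullDim (A ⧸ ⊥ ⊔ I) = ringKrullDim (A ⧸ I) :=
  ringKrullDim_eq_of_ringEquiv (quotEquivOfEq (bot_sup_eq I))

omit [IsNoetherianRing A] in
lemma IsWeaklyRegularMod.radical_ofList_eq (h : IsWeaklyRegularMod ⊥ l)
    (hm : ofList l ≤ maximalIdeal A) (hdim : ringKrullDim A = l.length) :
    (ofList l).radical = maximalIdeal A := by
  have hne : ofList l ≠ ⊤ := ne_top_of_le_ne_top (maximalIdeal.isMaximal A).ne_top hm
  have := Quotient.nontrivial_iff.2 hne
  have h1 := h.ringKrullDim_add_length_le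
  rw [ringKrullDim_quotient_bot, ringKrullDim_quotient_bot_sup, hdim] at h1
  refine (radical_eq_maximalIdeal_iff_ringKrullDim hne).2
    (le_antisymm ?_ ringKrullDim_nonneg_of_nontrivial)
  by_contra! hlt
  have h2 : (1 : WithBot ℕ∞) ≤ ringKrullDim (A ⧸ ofList l) := by
    simpa using ENat.WithBot.add_one_le_iff (n := 0).2 (by simpa using hlt)
  have h3 : (1 : WithBot ℕ∞) + l.length ≤ l.length := (add_le_add_left h2 _).trans h1
  have h4 : 1 + l.length ≤ l.length := by exact_mod_cast h3
  omega

lemma IsWeaklyRegularMod.ringKrullDim_eq_length (h : IsWeaklyRegularMod ⊥ l)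
    (hl : (ofList l).radical = maximalIdeal A) : ringKrullDim A = l.length := by
  have hne : ofList l ≠ ⊤ := fun e =>
    (maximalIdeal.isMaximal A).ne_top (hl ▸ radical_eq_top.2 e)
  have h0 := (radical_eq_maximalIdeal_iff_ringKrullDim hne).1 hl
  have h1 := h.ringKrullDim_add_length_le
  have h2 := ringKrullDim_quotient_le_add_length (H := ⊥) (l := l) (by rwa [bot_sup_eq])
  rw [ringKrullDim_quotient_bot, ringKrullDim_quotient_bot_sup, h0, zero_add] at h1 h2
  exact le_antisymm h2 h1

end Dimension

section Frobenius

variable {A : Type*} [CommRing A] (p : ℕ) [Fact p.Prime] [CharP A p]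

lemma bracketPow_eq_map (I : Ideal A) (e : ℕ) :
    bracketPow I (p ^ e) = map (iterateFrobenius A p e) I := rfl

lemma bracketPow_pow_zero (I : Ideal A) : bracketPow I (p ^ 0) = I := by
  rw [bracketPow_eq_map, show iterateFrobenius A p 0 = RingHom.id A from by ext; simp, map_id]

lemma bracketPow_sup (I J : Ideal A) (e : ℕ) :
    bracketPow (I ⊔ J) (p ^ e) = bracketPow I (p ^ e) ⊔ bracketPow J (p ^ e) := by
  simp only [bracketPow_eq_map, map_sup]

lemma bracketPow_span_singleton (x : A) (e : ℕ) :
    bracketPow (span {x}) (p ^ e) = span {x ^ p ^ e} := by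
  rw [bracketPow_eq_map, map_span, Set.image_singleton, iterateFrobenius_def]

lemma bracketPow_ofList (l : List A) (e : ℕ) :
    bracketPow (ofList l) (p ^ e) = ofList (l.map (· ^ p ^ e)) := by
  rw [bracketPow_eq_map, map_ofList]
  rfl

lemma bracketPow_map {B : Type*} [CommRing B] [CharP B p] (f : A →+* B) (I : Ideal A) (e : ℕ) :
    bracketPow (map f I) (p ^ e) = map f (bracketPow I (p ^ e)) := by
  simp only [bracketPow_eq_map, map_map]
  congr 1
  ext x
  simp [iterateFrobenius_def]

omit [Fact p.Prime] [CharP A p] in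
lemma pow_mem_bracketPow {I : Ideal A} {x : A} (hx : x ∈ I) (q : ℕ) : x ^ q ∈ bracketPow I q :=
  subset_span ⟨x, hx, rfl⟩

omit [Fact p.Prime] [CharP A p] in
lemma mem_ITilde_iff {I : Ideal A} {x c : A} :
    c ∈ ITilde p I x ↔ ∀ e, c * x ^ p ^ e ∈ bracketPow I (p ^ e) := by
  simp only [ITilde, Submodule.mem_iInf]
  refine forall_congr' fun e => ?_
  exact mem_colon_span_singleton

omit [Fact p.Prime] [CharP A p] in
lemma ITilde_eq_top_of_mem {I : Ideal A} {x : A} (hx : x ∈ I) : ITilde p I x = ⊤ :=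
  eq_top_iff.2 fun _ _ => (mem_ITilde_iff p).2 fun _ => mul_mem_left _ _ (pow_mem_bracketPow hx _)

/-- Some element outside `K` is multiplied by `Q` into `K`, compatibly with Frobenius. -/
def HasWitness (Q K : Ideal A) : Prop := ∃ w ∉ K, Q ≤ ITilde p K w

variable {p}

lemma mul_pow_mem_imp {H : Ideal A} {b : A} (hb : ∀ t, b * t ∈ H → t ∈ H) (k : ℕ) :
    ∀ t, b ^ k * t ∈ H → t ∈ H := by
  induction k with
  | zero => intro t ht; simpa using ht
  | succ k ih =>
    intro t ht
    rw [pow_succ, mul_assoc] at ht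
    exact hb t (ih _ ht)

lemma HasWitness.of_pow {Q B : Ideal A} {b : A} {M : ℕ}
    (hb : ∀ e t, b * t ∈ bracketPow B (p ^ e) → t ∈ bracketPow B (p ^ e))
    (h : HasWitness p Q (B ⊔ span {b ^ M})) : HasWitness p Q (B ⊔ span {b}) := by
  have hb0 : ∀ t, b * t ∈ B → t ∈ B := by simpa only [bracketPow_pow_zero] using hb 0
  obtain ⟨v, hv, hQ⟩ := h
  cases M with
  | zero => exact absurd (mem_sup_right (by simp)) hv
  | succ M =>
    have hex : ∃ k, b ^ k * v ∈ B ⊔ span {b ^ (M + 1)} :=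
      ⟨M + 1, mul_mem_right _ _ (mem_sup_right (mem_span_singleton_self _))⟩
    classical
    obtain ⟨k, hk⟩ : ∃ k, Nat.find hex = k := ⟨_, rfl⟩
    have hspec := Nat.find_spec hex
    rw [hk] at hspec
    cases k with
    | zero => exact absurd (by simpa using hspec) hv
    | succ k =>
      have hkv : b ^ k * v ∉ B ⊔ span {b ^ (M + 1)} := Nat.find_min hex (by omega)
      obtain ⟨r, hr⟩ := mem_sup_span_singleton_iff.1 hspec
      have hβ : b ^ k * v - b ^ M * r ∈ B := hb0 _ (by convert hr using 1; ring)
      refine ⟨r, fun hrB => hkv ?_, fun c hc => (mem_ITilde_iff p).2 fun e => ?_⟩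
      · obtain ⟨t, ht⟩ := mem_sup_span_singleton_iff.1 hrB
        refine mem_sup_span_singleton_iff.2 ⟨t, ?_⟩
        convert B.add_mem hβ (B.mul_mem_left (b ^ M) ht) using 1
        ring
      · have h1 := (mem_ITilde_iff p).1 (hQ hc) e
        rw [bracketPow_sup, bracketPow_span_singleton] at h1 ⊢
        obtain ⟨t, ht⟩ := mem_sup_span_singleton_iff.1 h1
        have h2 := pow_mem_bracketPow hβ (p ^ e)
        rw [sub_pow_char_pow] at h2
        refine mem_sup_span_singleton_iff.2 ⟨(b ^ k) ^ p ^ e * t,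
          mul_pow_mem_imp (hb e) (M * p ^ e) _ ?_⟩
        convert (bracketPow B (p ^ e)).sub_mem
          ((bracketPow B (p ^ e)).mul_mem_left ((b ^ k) ^ p ^ e) ht)
          ((bracketPow B (p ^ e)).mul_mem_left c h2) using 1
        simp only [mul_pow, ← pow_mul]
        ring

lemma HasWitness.exchange {Q B : Ideal A} {b c : A} {M : ℕ} (hM : b ^ M ∈ B ⊔ span {c})
    (hb : ∀ e t, b * t ∈ bracketPow B (p ^ e) → t ∈ bracketPow B (p ^ e))
    (h : HasWitness p Q (B ⊔ span {c})) : HasWitness p Q (B ⊔ span {b}) := by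
  have hb0 : ∀ t, b * t ∈ B → t ∈ B := by simpa only [bracketPow_pow_zero] using hb 0
  obtain ⟨w, hw, hQ⟩ := h
  obtain ⟨s, hs⟩ := mem_sup_span_singleton_iff.1 hM
  refine HasWitness.of_pow (M := M) hb
    ⟨s * w, fun hsw => hw ?_, fun x hx => (mem_ITilde_iff p).2 fun e => ?_⟩
  · obtain ⟨t, ht⟩ := mem_sup_span_singleton_iff.1 hsw
    refine mem_sup_span_singleton_iff.2 ⟨t, mul_pow_mem_imp hb0 M _ ?_⟩
    convert B.add_mem (B.mul_mem_left w hs) (B.mul_mem_left c ht) using 1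
    ring
  · have h1 := (mem_ITilde_iff p).1 (hQ hx) e
    rw [bracketPow_sup, bracketPow_span_singleton] at h1 ⊢
    obtain ⟨t, ht⟩ := mem_sup_span_singleton_iff.1 h1
    have h2 := pow_mem_bracketPow hs (p ^ e)
    rw [sub_pow_char_pow] at h2
    refine mem_sup_span_singleton_iff.2 ⟨t, ?_⟩
    convert (bracketPow B (p ^ e)).sub_mem
      ((bracketPow B (p ^ e)).mul_mem_left (s ^ p ^ e) ht)
      ((bracketPow B (p ^ e)).mul_mem_left t h2) using 1
    simp only [mul_pow]
    ring

lemma HasWitness.append_exchange [IsLocalRing A] [IsNoetherianRing A] {Q : Ideal A}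
    {ys as bs : List A} (hlen : as.length = bs.length) (hreg : IsWeaklyRegularMod ⊥ (ys ++ bs))
    (hbs : ∀ b ∈ bs, b ∈ maximalIdeal A)
    (hdim : ringKrullDim A = (ys.length + bs.length : ℕ))
    (hrad : (ofList (ys ++ as)).radical = maximalIdeal A)
    (h : HasWitness p Q (ofList (ys ++ as))) : HasWitness p Q (ofList (ys ++ bs)) := by
  induction as generalizing ys bs with
  | nil =>
    obtain rfl := List.length_eq_zero_iff.1 hlen.symm
    exact h
  | cons a as ih =>
    obtain ⟨b, bs, rfl⟩ := List.exists_cons_of_length_eq_add_one hlen.symm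
    have hle : ∀ x ∈ ys ++ a :: as, x ∈ maximalIdeal A := fun x hx =>
      hrad ▸ le_radical (subset_span hx)
    have hys : ∀ x ∈ ys, x ∈ maximalIdeal A := fun x hx => hle x (by simp [hx])
    have hperm : ∀ c : A, (ys ++ c :: bs).Perm (ys ++ bs ++ [c]) := fun c =>
      List.perm_middle.trans (List.perm_append_singleton c _).symm
    have hB : ∀ c, ofList (ys ++ c :: bs) = ofList (ys ++ bs) ⊔ span {c} := fun c => by
      rw [ofList_append, ofList_cons, ofList_append, sup_assoc, sup_comm (span {c})]
    have hreg' := hreg.perm (hperm b) fun x hx => by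
      rcases List.mem_append.1 hx with hx | hx
      exacts [hys x hx, hbs x hx]
    have hbB : ∀ e t, b * t ∈ bracketPow (ofList (ys ++ bs)) (p ^ e) →
        t ∈ bracketPow (ofList (ys ++ bs)) (p ^ e) := by
      intro e t ht
      have h1 := hreg'.map_pow (p ^ e)
      rw [List.map_append, IsWeaklyRegularMod.append_iff, bot_sup_eq,
        ← bracketPow_ofList] at h1
      refine h1.2.1 t ?_
      obtain ⟨k, hk⟩ := Nat.exists_eq_succ_of_ne_zero (pow_ne_zero e (Fact.out : p.Prime).ne_zero)
      have : b ^ p ^ e * t = b ^ k * (b * t) := by rw [hk, pow_succ, mul_assoc]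
      exact this ▸ Ideal.mul_mem_left _ _ ht
    rw [IsWeaklyRegularMod.append_iff, bot_sup_eq] at hreg'
    obtain ⟨T, hfin, hT, hTc⟩ := exists_finite_primes_of_zeroDivisors (ofList (ys ++ bs))
    obtain ⟨y, hy, hyT⟩ := exists_add_notMem_of_finite hfin (fun P hP => (hT P hP).1) a
      (ofList as) (by
        intro P hP ha has
        obtain ⟨hprime, t, htB, ht⟩ := hT P hP
        have hBP : ofList (ys ++ bs) ≤ P := fun x hx => (ht x).2 (mul_mem_right _ _ hx)
        have hall : ofList (ys ++ a :: as) ≤ P := ofList_le_iff.2 fun x hx => by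
          rcases List.mem_append.1 hx with hx | hx
          · exact hBP (subset_span (List.mem_append_left _ hx))
          · rcases List.mem_cons.1 hx with rfl | hx
            exacts [ha, has (subset_span hx)]
        have hbP : b ∈ P := hprime.radical_le_iff.2 hall (hrad.symm ▸ hbs b (by simp))
        exact htB (hreg'.2.1 t ((ht b).1 hbP)))
    have hym : y ∈ maximalIdeal A := ofList_le_iff.2 (fun x hx => hle x (by simp [hx])) hy
    have hcm : a + y ∈ maximalIdeal A := add_mem (hle a (by simp)) hym
    have hbs' : ∀ x ∈ bs, x ∈ maximalIdeal A := fun x hx => hbs x (List.mem_cons_of_mem _ hx)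
    have hall : ∀ x ∈ ys ++ bs ++ [a + y], x ∈ maximalIdeal A := by
      intro x hx
      simp only [List.mem_append, List.mem_singleton] at hx
      rcases hx with (hx | hx) | rfl
      exacts [hys x hx, hbs' x hx, hcm]
    have hregc : IsWeaklyRegularMod ⊥ (ys ++ bs ++ [a + y]) :=
      IsWeaklyRegularMod.append_iff.2 ⟨hreg'.1, by
        rw [bot_sup_eq]
        exact ⟨hTc _ hyT, trivial⟩⟩
    have heq : ofList (ys ++ [a + y] ++ as) = ofList (ys ++ a :: as) := by
      simp only [ofList_append, ofList_cons, ofList_nil, sup_bot_eq, sup_assoc]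
      congr 1
      refine le_antisymm (sup_le (span_singleton_le_of_mem ?_) le_sup_right)
        (sup_le (span_singleton_le_of_mem ?_) le_sup_right)
      · exact Submodule.add_mem_sup (mem_span_singleton_self a) hy
      · have := (span {a + y} ⊔ ofList as).sub_mem
          (mem_sup_left (mem_span_singleton_self (a + y))) (mem_sup_right hy)
        simpa using this
    have hstep := ih (ys := ys ++ [a + y]) (bs := bs) (by simpa using hlen)
      (by
        have := hregc.perm (hperm (a + y)).symm hall
        simpa using this) hbs'
      (by rw [hdim]; simp [add_comm, add_left_comm])
      (by rw [heq, hrad]) (by rwa [heq])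
    rw [List.append_assoc, List.singleton_append, hB] at hstep
    have hradc : (ofList (ys ++ bs) ⊔ span {a + y}).radical = maximalIdeal A := by
      have := hregc.radical_ofList_eq (ofList_le_iff.2 hall) (by
        rw [hdim]; simp)
      rwa [ofList_append, ofList_singleton] at this
    obtain ⟨M, hM⟩ : b ∈ (ofList (ys ++ bs) ⊔ span {a + y}).radical := hradc ▸ hbs b (by simp)
    rw [hB]
    exact hstep.exchange hM hbB

end Frobenius

end Ideal

namespace Ideal

open IsLocalRing

section Lists

variable {A : Type*} [CommRing A]

lemma ofList_ofFn {n : ℕ} (x : Fin n → A) : ofList (List.ofFn x) = span (Set.range x) := by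
  refine congrArg span (Set.ext fun a => ?_)
  simp [List.mem_ofFn]

lemma IsWeaklyRegularMod.of_isWeaklyRegular {H : Ideal A} {l : List A}
    (h : ∀ i (hi : i < l.length), ∀ t, l[i] * t ∈ H ⊔ ofList (l.take i) →
      t ∈ H ⊔ ofList (l.take i)) : IsWeaklyRegularMod H l := by
  induction l generalizing H with
  | nil => trivial
  | cons z zs ih =>
    refine ⟨by simpa [List.getElem_cons_zero] using fun t => h 0 (by simp) t, ih fun i hi t ht => ?_⟩
    have := h (i + 1) (by simpa using hi) t
    simp only [List.getElem_cons_succ, List.take_succ_cons, ofList_cons, ← sup_assoc] at this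
    exact this ht

lemma isWeaklyRegularMod_bot_of_isWeaklyRegular {l : List A}
    (h : RingTheory.Sequence.IsWeaklyRegular A l) : IsWeaklyRegularMod ⊥ l := by
  refine .of_isWeaklyRegular fun i hi t ht => ?_
  have := (isSMulRegular_quotient_iff_mem_of_smul_mem _ _).1
    ((RingTheory.Sequence.isWeaklyRegular_iff A l).1 h i hi) t
  rw [bot_sup_eq] at ht ⊢
  simpa using this (by simpa using ht)

lemma exists_list_isParameterIdeal [IsLocalRing A] {I : Ideal A} (hI : IsParameterIdeal I) :
    ∃ l : List A, ringKrullDim A = l.length ∧ I = ofList l ∧ I.radical = maximalIdeal A := by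
  obtain ⟨n, x, hdim, hx, hrad⟩ := hI
  exact ⟨List.ofFn x, by simpa using hdim, by rw [hx, ofList_ofFn], hrad⟩

lemma isParameterIdeal_ofList [IsLocalRing A] {l : List A} (hdim : ringKrullDim A = l.length)
    (hrad : (ofList l).radical = maximalIdeal A) : IsParameterIdeal (ofList l) :=
  ⟨l.length, l.get, hdim, by rw [← ofList_ofFn, List.ofFn_get], hrad⟩

lemma exists_list_sup_eq_maximalIdeal [IsLocalRing A] {H : Ideal A}
    (h : IsRegularLocal (A ⧸ H)) :
    ∃ zs : List A, ringKrullDim (A ⧸ H) = zs.length ∧ H ⊔ ofList zs = maximalIdeal A := by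
  obtain ⟨-, hloc, n, z, hdim, hz⟩ := h
  choose y hy using fun i => Quotient.mk_surjective (z i)
  refine ⟨List.ofFn y, by simpa using hdim, ?_⟩
  have hmap : map (Quotient.mk H) (ofList (List.ofFn y)) = maximalIdeal (A ⧸ H) := by
    rw [hz, map_ofList, List.map_ofFn, ofList_ofFn, show Quotient.mk H ∘ y = z from funext hy]
  have hcomap := comap_map_of_surjective (Quotient.mk H) Quotient.mk_surjective
    (ofList (List.ofFn y))
  rw [hmap, ← RingHom.ker_eq_comap_bot, mk_ker, sup_comm] at hcomap
  rw [← hcomap]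
  exact IsLocalRing.eq_maximalIdeal
    (comap_isMaximal_of_surjective (Quotient.mk H) Quotient.mk_surjective)

lemma maximalIdeal_le_radical_bracketPow [IsLocalRing A] {G : Ideal A}
    (hG : maximalIdeal A ≤ G.radical) (q : ℕ) : maximalIdeal A ≤ (bracketPow G q).radical := by
  intro x hx
  obtain ⟨k, hk⟩ := hG hx
  exact ⟨k * q, by rw [pow_mul]; exact pow_mem_bracketPow hk q⟩

end Lists

variable {R S : Type*} [CommRing R] [IsLocalRing R] [IsNoetherianRing R]
  [CommRing S] [IsLocalRing S] [IsNoetherianRing S] {f : R →+* S} {zs : List S}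

lemma mem_map_maximalIdeal_of_forall_mul_pow_mem (p : ℕ) [Fact p.Prime] [CharP R p] [CharP S p]
    (hf : f.Flat) (hreg : IsWeaklyRegularMod (map f (maximalIdeal R)) zs)
    (hmax : map f (maximalIdeal R) ⊔ ofList zs = maximalIdeal S)
    {G : Ideal R} (hG : maximalIdeal R ≤ G.radical) (hGF : FrobeniusClosed p G)
    {r : R} (hr : r ∉ G) {c : S}
    (hc : ∀ e, c * f r ^ p ^ e ∈ bracketPow (map f G ⊔ ofList zs) (p ^ e)) :
    c ∈ map f (maximalIdeal R) := by
  have hne : map f (maximalIdeal R) ≠ ⊤ :=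
    ne_top_of_le_ne_top (maximalIdeal.isMaximal S).ne_top (hmax ▸ le_sup_left)
  refine mem_of_forall_mem_sup_maximalIdeal_pow hne fun k => ?_
  have h1 := hc k
  rw [bracketPow_sup, bracketPow_map, bracketPow_ofList, ← map_pow f] at h1
  have h2 := mem_map_maximalIdeal_sup_of_mul_mem hf (hreg.map_pow (p ^ k))
    (maximalIdeal_le_radical_bracketPow hG (p ^ k)) (fun h => hr (hGF r ⟨k, h⟩)) h1
  have hle : ofList (zs.map (· ^ p ^ k)) ≤ maximalIdeal S ^ k := by
    refine ofList_le_iff.2 fun x hx => ?_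
    obtain ⟨z, hz, rfl⟩ := List.mem_map.1 hx
    have hzm : z ∈ maximalIdeal S := hmax ▸ mem_sup_right (subset_span hz)
    exact pow_le_pow_right (Nat.lt_pow_self (Fact.out : p.Prime).one_lt).le
      (pow_mem_pow hzm (p ^ k))
  exact sup_le_sup_left hle _ h2

omit [IsNoetherianRing R] [IsNoetherianRing S] in
lemma radical_map_sup_ofList (hmax : map f (maximalIdeal R) ⊔ ofList zs = maximalIdeal S)
    {G : Ideal R} (hG : G.radical = maximalIdeal R) :
    (map f G ⊔ ofList zs).radical = maximalIdeal S := by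
  refine le_antisymm ((IsPrime.radical_le_iff inferInstance).2 ?_) ?_
  · rw [← hmax, ← hG]
    exact sup_le_sup_right (map_mono le_radical) _
  · conv_lhs => rw [← hmax, ← hG]
    exact sup_le ((map_radical_le f).trans (radical_mono le_sup_left))
      (le_sup_right.trans le_radical)

end Ideal

/-- **(Enescu.)** Let `(R, 𝔪, k) → (S, 𝔫, k)` be a flat local homomorphism of Cohen–Macaulay
Noetherian local rings of prime characteristic `p` in which every parameter ideal is
Frobenius closed, inducing an isomorphism on residue fields.  Assume the closed fiber `S/𝔪S`
is a regular local ring and that `R` is F-stable, i.e. there are a parameter ideal `I` of `R`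
and `u ∈ R` with `I(u) = 𝔪`.  Then `𝔪S` is a maximal element of
`B(S) = {P ∈ Spec S : P = J(w) for some parameter ideal J of S and w ∈ S}`. -/
theorem map_maximalIdeal_maximal_in_bSet
    {R S : Type*} [CommRing R] [IsLocalRing R] [IsNoetherianRing R]
    [CommRing S] [IsLocalRing S] [IsNoetherianRing S]
    (p : ℕ) [Fact p.Prime] [CharP R p] [CharP S p]
    (f : R →+* S) [IsLocalHom f] (hflat : f.Flat)
    (hres : Function.Bijective (IsLocalRing.ResidueField.map f))
    (hCMR : IsCohenMacaulayLocal R) (hCMS : IsCohenMacaulayLocal S)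
    (hfrobR : ∀ J : Ideal R, IsParameterIdeal J → FrobeniusClosed p J)
    (hfrobS : ∀ J : Ideal S, IsParameterIdeal J → FrobeniusClosed p J)
    (hfiber : IsRegularLocal (S ⧸ Ideal.map f (IsLocalRing.maximalIdeal R)))
    (hstable : ∃ (I : Ideal R) (u : R), IsParameterIdeal I ∧
      ITilde p I u = IsLocalRing.maximalIdeal R) :
    Ideal.map f (IsLocalRing.maximalIdeal R) ∈ bSet p S ∧
    ∀ Q ∈ bSet p S, Ideal.map f (IsLocalRing.maximalIdeal R) ≤ Q →
      Q = Ideal.map f (IsLocalRing.maximalIdeal R) := by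

  have hfib := Ideal.exists_list_sup_eq_maximalIdeal hfiber
  obtain ⟨zs, hzdim, hmax⟩ := hfib
  obtain ⟨hprime, hzreg⟩ := Ideal.isPrime_and_isWeaklyRegularMod hmax hzdim.ge
  obtain ⟨d, x, hdimR, hxrad, hxreg⟩ := hCMR
  rw [← Ideal.ofList_ofFn] at hxrad
  have hparam : IsParameterIdeal (Ideal.ofList (List.ofFn x)) :=
    Ideal.isParameterIdeal_ofList (by simpa using hdimR) hxrad
  have hsum (l : List R) : Ideal.ofList (l.map f ++ zs) =
      Ideal.map f (Ideal.ofList l) ⊔ Ideal.ofList zs := by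
    rw [Ideal.ofList_append, Ideal.map_ofList]
  have hreg : Ideal.IsWeaklyRegularMod ⊥ ((List.ofFn x).map f ++ zs) := by
    refine Ideal.IsWeaklyRegularMod.append_iff.2 ⟨?_, ?_⟩
    · have := (Ideal.isWeaklyRegularMod_bot_of_isWeaklyRegular hxreg.toIsWeaklyRegular).map hflat
      rwa [Ideal.map_bot] at this
    · rw [bot_sup_eq, ← Ideal.map_ofList]
      exact hzreg.map_of_le_radical hflat _ hxrad.ge
  have hdimS := hreg.ringKrullDim_eq_length (by
    rw [hsum]; exact Ideal.radical_map_sup_ofList hmax hxrad)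
  obtain ⟨I, u, hI, hIu⟩ := hstable
  refine ⟨⟨hprime, Ideal.map f I ⊔ Ideal.ofList zs, f u, ?_, le_antisymm ?_ fun c hc => ?_⟩, ?_⟩
  · obtain ⟨l, hl, rfl, hlrad⟩ := Ideal.exists_list_isParameterIdeal hI
    have hld : l.length = d := by exact_mod_cast hl.symm.trans hdimR
    rw [← hsum]
    refine Ideal.isParameterIdeal_ofList ?_ ?_
    · rw [hdimS]
      simp [hld]
    · rw [hsum]
      exact Ideal.radical_map_sup_ofList hmax hlrad
  · rw [Ideal.map_le_iff_le_comap, ← hIu]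
    refine fun c hc => (Ideal.mem_ITilde_iff p).2 fun e => ?_
    rw [Ideal.bracketPow_sup, Ideal.bracketPow_map, ← map_pow, ← map_mul]
    exact Ideal.mem_sup_left (Ideal.mem_map_of_mem f ((Ideal.mem_ITilde_iff p).1 hc e))
  · have hu : u ∉ I := fun h => (IsLocalRing.maximalIdeal.isMaximal R).ne_top
      (hIu.symm.trans (Ideal.ITilde_eq_top_of_mem p h))
    have hIrad := hI.choose_spec.choose_spec.2.2
    exact Ideal.mem_map_maximalIdeal_of_forall_mul_pow_mem p hflat hzreg hmax hIrad.ge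
      (hfrobR I hI) hu ((Ideal.mem_ITilde_iff p).1 hc)
  · rintro Q ⟨hQ, K, w, hK, hQK⟩ hle
    refine le_antisymm (fun c hc => ?_) hle
    have hw : w ∉ K := fun h => hQ.ne_top (hQK.trans (Ideal.ITilde_eq_top_of_mem p h))
    obtain ⟨l, hl, rfl, hlrad⟩ := Ideal.exists_list_isParameterIdeal hK
    have hlen : l.length = ((List.ofFn x).map f ++ zs).length := by
      exact_mod_cast hl.symm.trans hdimS
    obtain ⟨v, hv, hQv⟩ := Ideal.HasWitness.append_exchange (p := p) (Q := Q) (ys := [])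
      hlen hreg
      (fun b hb => by
        have := Ideal.radical_map_sup_ofList hmax hxrad
        rw [← hsum] at this
        exact this ▸ Ideal.le_radical (Ideal.subset_span hb))
      (by simpa using hdimS) hlrad ⟨w, hw, hQK.le⟩
    rw [List.nil_append, hsum] at hv hQv
    obtain ⟨N, hN⟩ := Ideal.exists_radical_pow_le_of_fg (Ideal.ofList (List.ofFn x))
      (IsNoetherian.noetherian _)
    rw [hxrad] at hN
    obtain ⟨r, hr⟩ := Ideal.exists_sub_mem_map_maximalIdeal_pow_sup hres.surjective hmax N v
    have hvr := sup_le_sup_right (Ideal.map_mono (f := f) hN) (Ideal.ofList zs) hr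
    refine Ideal.mem_map_maximalIdeal_of_forall_mul_pow_mem p hflat hzreg hmax hxrad.ge
      (hfrobR _ hparam) (r := r) (fun h => hv ?_) fun e => ?_
    · have := Ideal.add_mem _ hvr (Ideal.mem_sup_left (Ideal.mem_map_of_mem f h))
      simpa using this
    · have h1 := (Ideal.mem_ITilde_iff p).1 (hQv hc) e
      have h2 := Ideal.mul_mem_left _ c (Ideal.pow_mem_bracketPow hvr (p ^ e))
      rw [sub_pow_char_pow] at h2
      convert Ideal.sub_mem _ h1 h2 using 1
      ring
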